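/- Let n > 3 and let M be a separable hypersurface {x ∈ ℝⁿ : f₁(x₁)+...+fₙ(xₙ)=0} in ℝⁿ with all sectional curvatures equal to a nonzero constant. Then M is (an open subset of) a round hypersphere Σₖ(xₖ + μₖ)² = r². -/

import Mathlib

open Filter Topology

namespace SepHyp

set_option linter.unusedSimpArgs false

noncomputable def fu {n : ℕ} (f : Fin n → ℝ → ℝ) (l : Fin n) : ℝ → ℝ := deriv (f l)
noncomputable def fA {n : ℕ} (f : Fin n → ℝ → ℝ) (l : Fin n) (t : ℝ) : ℝ := (fu f l t) ^ 2
noncomputable def fp {n : ℕ} (f : Fin n → ℝ → ℝ) (l : Fin n) : ℝ → ℝ := deriv (deriv (f l))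
noncomputable def fr {n : ℕ} (f : Fin n → ℝ → ℝ) (l : Fin n) (t : ℝ) : ℝ :=
  deriv (fp f l) t / fu f l t
noncomputable def fs {n : ℕ} (f : Fin n → ℝ → ℝ) (l : Fin n) (t : ℝ) : ℝ :=
  deriv (fr f l) t / fu f l t

def ep {n : ℕ} (α β l : Fin n) : ℝ := if l = α then 1 else if l = β then -1 else 0

lemma cd_deriv {g : ℝ → ℝ} (h : ContDiff ℝ (⊤ : ℕ∞) g) : ContDiff ℝ (⊤ : ℕ∞) (deriv g) :=
  (contDiff_infty_iff_deriv.1 h).2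

lemma cd_diff {g : ℝ → ℝ} (h : ContDiff ℝ (⊤ : ℕ∞) g) : Differentiable ℝ g :=
  (contDiff_infty_iff_deriv.1 h).1

lemma fu_cd {n : ℕ} {f : Fin n → ℝ → ℝ} (hf : ∀ k, ContDiff ℝ (⊤ : ℕ∞) (f k))
    (l) : ContDiff ℝ (⊤ : ℕ∞) (fu f l) := cd_deriv (hf l)
lemma fp_cd {n : ℕ} {f : Fin n → ℝ → ℝ} (hf : ∀ k, ContDiff ℝ (⊤ : ℕ∞) (f k))
    (l) : ContDiff ℝ (⊤ : ℕ∞) (fp f l) := cd_deriv (cd_deriv (hf l))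

/-- curves in the surface -/
lemma curve {n : ℕ} {f : Fin n → ℝ → ℝ} (hf : ∀ k, ContDiff ℝ (⊤ : ℕ∞) (f k))
    (x : Fin n → ℝ) (α β : Fin n) (hab : α ≠ β) (hβ : fu f β (x β) ≠ 0) (v : ℝ) :
    ∃ γ : ℝ → Fin n → ℝ, γ 0 = x ∧ (∀ t, γ t α = x α + v * t) ∧
      (∀ l, l ≠ α → l ≠ β → ∀ t, γ t l = x l) ∧
      HasDerivAt (fun t => γ t β) (- (fu f α (x α) * v) / fu f β (x β)) 0 ∧
      ∀ᶠ t in 𝓝 (0:ℝ), ∑ l, f l (γ t l) = ∑ l, f l (x l) := by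
  have hs : HasStrictDerivAt (f β) (fu f β (x β)) (x β) :=
    ((hf β).contDiffAt).hasStrictDerivAt (by simp)
  set g := hs.localInverse (f β) (fu f β (x β)) (x β) hβ with hg
  have hgd : HasDerivAt g (fu f β (x β))⁻¹ (f β (x β)) := (hs.to_localInverse hβ).hasDerivAt
  have hgx : g (f β (x β)) = x β :=
    HasStrictFDerivAt.localInverse_apply_image (hs.hasStrictFDerivAt_equiv hβ)
  have hgr : ∀ᶠ y in 𝓝 (f β (x β)), f β (g y) = y :=
    HasStrictFDerivAt.eventually_right_inverse (hs.hasStrictFDerivAt_equiv hβ)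
  set w : ℝ → ℝ := fun t => f β (x β) + f α (x α) - f α (x α + v * t) with hw
  have hw0 : w 0 = f β (x β) := by simp [hw]
  have hwd : HasDerivAt w (- (fu f α (x α) * v)) 0 := by
    have h1 : HasDerivAt (fun t : ℝ => x α + v * t) v 0 := by
      simpa using ((hasDerivAt_id (0:ℝ)).const_mul v).const_add (x α)
    have h2 : HasDerivAt (f α) (fu f α (x α)) (x α + v * 0) := by
      rw [mul_zero, add_zero]
      exact (cd_diff (hf α) (x α)).hasDerivAt
    have := (h2.comp (0:ℝ) h1).const_sub (f β (x β) + f α (x α))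
    exact this
  refine ⟨fun t => Function.update (Function.update x α (x α + v * t)) β (g (w t)), ?_, ?_, ?_, ?_, ?_⟩
  · funext l
    by_cases h1 : l = β
    · subst h1; simp [hw0, hgx]
    · by_cases h2 : l = α
      · subst h2; simp [h1]
      · simp [h1, h2]
  · intro t; simp [hab]
  · intro l h1 h2 t; simp [h1, h2]
  · have : HasDerivAt (fun t => g (w t)) ((fu f β (x β))⁻¹ * (- (fu f α (x α) * v))) 0 := by
      refine HasDerivAt.comp (0:ℝ) ?_ hwd
      rw [hw0]; exact hgd
    simp only [Function.update_self]
    convert this using 1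
    rw [div_eq_inv_mul]
  · have hc : ContinuousAt w 0 := hwd.continuousAt
    have := hc.tendsto
    rw [hw0] at this
    filter_upwards [this.eventually hgr] with t ht
    have key : ∀ F : Fin n → ℝ, ∑ l, F l = F β + (F α + ∑ l ∈ (Finset.univ.erase β).erase α, F l) := by
      intro F
      rw [Finset.add_sum_erase _ _ (by simp [hab]), Finset.add_sum_erase _ _ (by simp)]
    rw [key, key (fun l => f l (x l))]
    have hrest : ∑ l ∈ (Finset.univ.erase β).erase α,
        f l (Function.update (Function.update x α (x α + v * t)) β (g (w t)) l) =
        ∑ l ∈ (Finset.univ.erase β).erase α, f l (x l) := by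
      apply Finset.sum_congr rfl
      intro l hl
      simp at hl
      simp [hl.1, hl.2]
    rw [hrest]
    simp only [Function.update_self, Function.update_of_ne hab, ht]
    simp only [hw]
    ring

lemma jets {n : ℕ} {f : Fin n → ℝ → ℝ} (hf : ∀ k, ContDiff ℝ (⊤ : ℕ∞) (f k))
    {U : Set (Fin n → ℝ)} (hU : IsOpen U) {x : Fin n → ℝ} (hx : x ∈ U)
    (hM : ∑ l, f l (x l) = 0) (α β : Fin n) (hab : α ≠ β) (hα : fu f α (x α) ≠ 0)
    (hβ : fu f β (x β) ≠ 0) :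
    ∃ γ : ℝ → Fin n → ℝ, γ 0 = x ∧ (∀ᶠ t in 𝓝 (0:ℝ), γ t ∈ U ∧ ∑ l, f l (γ t l) = 0) ∧
      (∀ l, HasDerivAt (fun t => fA f l (γ t l)) (2 * fp f l (x l) * ep α β l) 0) ∧
      (∀ l, HasDerivAt (fun t => fp f l (γ t l)) (fr f l (x l) * ep α β l) 0) ∧
      (∀ l, fu f l (x l) ≠ 0 → HasDerivAt (fun t => fr f l (γ t l)) (fs f l (x l) * ep α β l) 0) ∧
      HasDerivAt (fun t => ∑ l, fA f l (γ t l)) (2 * fp f α (x α) - 2 * fp f β (x β)) 0 := by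
  obtain ⟨γ, h0, h1, h2, h3, h4⟩ := curve hf x α β hab hβ (fu f α (x α))⁻¹
  have hd : ∀ l, HasDerivAt (fun t => γ t l) (ep α β l / fu f l (x l)) 0 := by
    intro l
    by_cases ha : l = α
    · subst ha
      simp only [h1, ep, if_true]
      simpa using ((hasDerivAt_id (0:ℝ)).const_mul (fu f l (x l))⁻¹).const_add (x l)
    · by_cases hb : l = β
      · subst hb
        simp only [ep, if_neg ha, if_true]
        rwa [mul_inv_cancel₀ hα] at h3
      · simp only [h2 l ha hb, ep, if_neg ha, if_neg hb, zero_div]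
        exact hasDerivAt_const _ _
  have hH : ∀ l, ∀ H : ℝ → ℝ, DifferentiableAt ℝ H (x l) →
      HasDerivAt (fun t => H (γ t l)) (deriv H (x l) * (ep α β l / fu f l (x l))) 0 := by
    intro l H hdH
    refine HasDerivAt.comp (0:ℝ) ?_ (hd l)
    rw [h0]; exact hdH.hasDerivAt
  have hA : ∀ l, HasDerivAt (fun t => fA f l (γ t l)) (2 * fp f l (x l) * ep α β l) 0 := by
    intro l
    have hdu := cd_diff (fu_cd hf l) (x l)
    have e1 : HasDerivAt (fA f l) (2 * fu f l (x l) * fp f l (x l)) (x l) := by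
      have := hdu.hasDerivAt.fun_pow 2
      refine this.congr_deriv ?_
      simp [fp, fu]
    have := hH l (fA f l) e1.differentiableAt
    rw [e1.deriv] at this
    convert this using 1
    by_cases hu : fu f l (x l) = 0
    · have : ep α β l = 0 := by
        have ha : l ≠ α := by rintro rfl; exact hα hu
        have hb : l ≠ β := by rintro rfl; exact hβ hu
        simp [ep, ha, hb]
      simp [this]
    · field_simp
  refine ⟨γ, h0, ?_, hA, ?_, ?_, ?_⟩
  · have hc : ContinuousAt γ 0 := continuousAt_pi.2 fun l => (hd l).continuousAt
    have : ∀ᶠ t in 𝓝 (0:ℝ), γ t ∈ U := hc.eventually_mem (by rw [h0]; exact hU.mem_nhds hx)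
    filter_upwards [this, h4] with t ht1 ht2
    exact ⟨ht1, ht2.trans hM⟩
  · intro l
    convert hH l (fp f l) (cd_diff (fp_cd hf l) _) using 1
    simp only [fr]; ring
  · intro l hu
    have : DifferentiableAt ℝ (fr f l) (x l) :=
      (cd_diff (cd_deriv (fp_cd hf l)) _).div (cd_diff (fu_cd hf l) _) hu
    convert hH l (fr f l) this using 1
    simp only [fs]; ring
  · have := HasDerivAt.fun_sum (u := Finset.univ) (fun l _ => hA l)
    refine this.congr_deriv ?_
    have hsplit : ∀ l, 2 * fp f l (x l) * ep α β l =
        (if l = α then 2 * fp f l (x l) else 0) - (if l = β then 2 * fp f l (x l) else 0) := by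
      intro l
      unfold ep
      by_cases ha : l = α
      · have : l ≠ β := by rw [ha]; exact hab
        simp [ha, hab]
      · by_cases hb : l = β <;> simp [ha, hb, hab.symm]
    rw [Finset.sum_congr rfl (fun l _ => hsplit l), Finset.sum_sub_distrib]
    simp

lemma zero_deriv {Φ : ℝ → ℝ} {d : ℝ} (hd : HasDerivAt Φ d 0) (h : ∀ᶠ t in 𝓝 (0:ℝ), Φ t = 0) :
    d = 0 :=
  hd.unique ((hasDerivAt_const (0:ℝ) (0:ℝ)).congr_of_eventuallyEq h)

structure Ctx {n : ℕ} (f : Fin n → ℝ → ℝ) (c : ℝ) (i j k m : Fin n)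
    (U : Set (Fin n → ℝ)) : Prop where
  hf : ∀ k, ContDiff ℝ (⊤ : ℕ∞) (f k)
  hc : c ≠ 0
  hU : IsOpen U
  hij : i ≠ j
  hik : i ≠ k
  him : i ≠ m
  hjk : j ≠ k
  hjm : j ≠ m
  hkm : k ≠ m
  hui : ∀ x ∈ U, fu f i (x i) ≠ 0
  huj : ∀ x ∈ U, fu f j (x j) ≠ 0
  huk : ∀ x ∈ U, fu f k (x k) ≠ 0
  hum : ∀ x ∈ U, fu f m (x m) ≠ 0
  he : ∀ x ∈ U, ∑ l, f l (x l) = 0 → ∀ α β : Fin n, α ≠ β → α ≠ m → β ≠ m →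
    fA f α (x α) * fp f β (x β) * fp f m (x m) + fA f β (x β) * fp f α (x α) * fp f m (x m) +
      fA f m (x m) * fp f α (x α) * fp f β (x β) =
      c * (∑ l, fA f l (x l)) * (fA f α (x α) + fA f β (x β) + fA f m (x m))

namespace Ctx
variable {n : ℕ} {f : Fin n → ℝ → ℝ} {c : ℝ} {i j k m : Fin n} {U : Set (Fin n → ℝ)}

lemma mono (h : Ctx f c i j k m U) {V : Set (Fin n → ℝ)} (hV : IsOpen V) (hVU : V ⊆ U) :
    Ctx f c i j k m V :=
  { h with
    hU := hV
    hui := fun x hx => h.hui x (hVU hx)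
    huj := fun x hx => h.huj x (hVU hx)
    huk := fun x hx => h.huk x (hVU hx)
    hum := fun x hx => h.hum x (hVU hx)
    he := fun x hx => h.he x (hVU hx) }

/-- cyclic rotation -/
lemma rot (h : Ctx f c i j k m U) : Ctx f c j k i m U :=
  { h with
    hij := h.hjk, hik := h.hij.symm, him := h.hjm, hjk := h.hik.symm, hjm := h.hkm, hkm := h.him
    hui := h.huj, huj := h.huk, huk := h.hui }

lemma swap (h : Ctx f c i j k m U) : Ctx f c i k j m U :=
  { h with
    hij := h.hik, hik := h.hij, hjk := h.hjk.symm, hjm := h.hkm, hkm := h.hjm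
    huj := h.huk, huk := h.huj }

lemma Apos {l : Fin n} {t : ℝ} (h : fu f l t ≠ 0) : 0 < fA f l t := by
  unfold fA; positivity

lemma rhs_ne (h : Ctx f c i j k m U) {x} (hx : x ∈ U) (α β : Fin n) :
    c * (∑ l, fA f l (x l)) * (fA f α (x α) + fA f β (x β) + fA f m (x m)) ≠ 0 := by
  have hm := Apos (h.hum x hx)
  have h0 : ∀ l, 0 ≤ fA f l (x l) := fun l => sq_nonneg _
  have h1 : fA f m (x m) ≤ ∑ l, fA f l (x l) :=
    Finset.single_le_sum (f := fun l => fA f l (x l)) (fun l _ => h0 l) (Finset.mem_univ m)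
  have h2 := h0 α
  have h3 := h0 β
  refine mul_ne_zero (mul_ne_zero h.hc ?_) ?_ <;> linarith

/-- equation (1) -/
lemma eq1 (h : Ctx f c i j k m U) {x} (hx : x ∈ U) (hM : ∑ l, f l (x l) = 0) :
    (fp f j (x j) - fp f k (x k)) * (fA f i (x i) * fp f m (x m) + fA f m (x m) * fp f i (x i)) -
     (fA f j (x j) - fA f k (x k)) * (c * (∑ l, fA f l (x l)) - fp f i (x i) * fp f m (x m)) = 0 := by
  have h1 := h.he x hx hM i j h.hij h.him h.hjm
  have h2 := h.he x hx hM i k h.hik h.him h.hkm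
  linear_combination h1 - h2

/-- equations obtained by differentiating (1) -/
lemma eq1_jk (h : Ctx f c i j k m U) {x} (hx : x ∈ U) (hM : ∑ l, f l (x l) = 0) :
    (fr f j (x j) + fr f k (x k)) * (fA f i (x i) * fp f m (x m) + fA f m (x m) * fp f i (x i)) =
     2 * (fp f j (x j) + fp f k (x k)) * (c * (∑ l, fA f l (x l)) - fp f i (x i) * fp f m (x m))
      + (fA f j (x j) - fA f k (x k)) * (2 * c * (fp f j (x j) - fp f k (x k))) := by
  obtain ⟨γ, g0, gU, gA, gp, -, gS⟩ := jets h.hf h.hU hx hM j k h.hjk (h.huj x hx) (h.huk x hx)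
  have hd := (((gp j).sub (gp k)).mul (((gA i).mul (gp m)).add ((gA m).mul (gp i)))).sub
    (((gA j).sub (gA k)).mul ((gS.const_mul c).sub ((gp i).mul (gp m))))
  have := zero_deriv hd (by filter_upwards [gU] with t ht using h.eq1 ht.1 ht.2)
  simp [g0, ep, h.hij, h.hik, h.him, h.hjk, h.hjm, h.hkm, h.hij.symm, h.hik.symm, h.him.symm,
    h.hjk.symm, h.hjm.symm, h.hkm.symm] at this
  linear_combination this

lemma eq1_im (h : Ctx f c i j k m U) {x} (hx : x ∈ U) (hM : ∑ l, f l (x l) = 0) :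
    (fp f j (x j) - fp f k (x k)) * (fA f m (x m) * fr f i (x i) - fA f i (x i) * fr f m (x m)) =
     (fA f j (x j) - fA f k (x k)) * (2 * c * (fp f i (x i) - fp f m (x m))
       - fr f i (x i) * fp f m (x m) + fp f i (x i) * fr f m (x m)) := by
  obtain ⟨γ, g0, gU, gA, gp, -, gS⟩ := jets h.hf h.hU hx hM i m h.him (h.hui x hx) (h.hum x hx)
  have hd := (((gp j).sub (gp k)).mul (((gA i).mul (gp m)).add ((gA m).mul (gp i)))).sub
    (((gA j).sub (gA k)).mul ((gS.const_mul c).sub ((gp i).mul (gp m))))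
  have := zero_deriv hd (by filter_upwards [gU] with t ht using h.eq1 ht.1 ht.2)
  simp [g0, ep, h.hij, h.hik, h.him, h.hjk, h.hjm, h.hkm, h.hij.symm, h.hik.symm, h.him.symm,
    h.hjk.symm, h.hjm.symm, h.hkm.symm] at this
  linear_combination this

lemma eq3 (h : Ctx f c i j k m U) {x} (hx : x ∈ U) (hM : ∑ l, f l (x l) = 0) :
    (fA f i (x i) * fp f m (x m) + fA f m (x m) * fp f i (x i)) *
      ((fA f j (x j) - fA f k (x k)) * (fr f j (x j) + fr f k (x k))
        - 2 * (fp f j (x j) * fp f j (x j) - fp f k (x k) * fp f k (x k))) -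
     2 * c * ((fA f j (x j) - fA f k (x k)) * (fA f j (x j) - fA f k (x k)) *
       (fp f j (x j) - fp f k (x k))) = 0 := by
  have h1 := h.eq1 hx hM
  have h2 := h.eq1_jk hx hM
  linear_combination (fA f j (x j) - fA f k (x k)) * h2 - 2 * (fp f j (x j) + fp f k (x k)) * h1

lemma eq3_im (h : Ctx f c i j k m U) {x} (hx : x ∈ U) (hM : ∑ l, f l (x l) = 0) :
    (fA f m (x m) * fr f i (x i) - fA f i (x i) * fr f m (x m)) *
      ((fA f j (x j) - fA f k (x k)) * (fr f j (x j) + fr f k (x k))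
        - 2 * (fp f j (x j) * fp f j (x j) - fp f k (x k) * fp f k (x k))) = 0 := by
  obtain ⟨γ, g0, gU, gA, gp, gr, gS⟩ := jets h.hf h.hU hx hM i m h.him (h.hui x hx) (h.hum x hx)
  have grj := gr j (h.huj x hx)
  have grk := gr k (h.huk x hx)
  have hd := ((((gA i).mul (gp m)).add ((gA m).mul (gp i))).mul
    ((((gA j).sub (gA k)).mul (grj.add grk)).sub
      ((((gp j).mul (gp j)).sub ((gp k).mul (gp k))).const_mul 2))).sub
    (((((gA j).sub (gA k)).mul ((gA j).sub (gA k))).mul ((gp j).sub (gp k))).const_mul (2 * c))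
  have := zero_deriv hd (by filter_upwards [gU] with t ht using h.eq3 ht.1 ht.2)
  simp only [g0, ep, h.hij, h.hik, h.him, h.hjk, h.hjm, h.hkm, h.hij.symm, h.hik.symm, h.him.symm,
    h.hjk.symm, h.hjm.symm, h.hkm.symm, if_true, if_false, Pi.mul_apply, Pi.add_apply,
    Pi.sub_apply] at this
  linear_combination this

/-- if the `j`, `k` data are distinct then `p i = p m`. -/
lemma main_alt (h : Ctx f c i j k m U)
    (hA : ∀ x ∈ U, ∑ l, f l (x l) = 0 → fA f j (x j) ≠ fA f k (x k))
    (hA' : ∀ x ∈ U, ∑ l, f l (x l) = 0 → fA f i (x i) ≠ fA f m (x m))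
    (hp : ∀ x ∈ U, ∑ l, f l (x l) = 0 → fp f j (x j) ≠ fp f k (x k)) :
    ∀ x ∈ U, ∑ l, f l (x l) = 0 → fp f i (x i) = fp f m (x m) := by
  have e1 : ∀ x ∈ U, ∑ l, f l (x l) = 0 →
      fA f m (x m) * fr f i (x i) - fA f i (x i) * fr f m (x m) = 0 := by
    intro x hx hM
    have h3 := h.eq3 hx hM
    have h4 := h.eq3_im hx hM
    rcases mul_eq_zero.1 h4 with h5 | h5
    · exact h5
    · exfalso
      rw [h5] at h3
      have hA1 := sub_ne_zero.2 (hA x hx hM)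
      have hp1 := sub_ne_zero.2 (hp x hx hM)
      have hne : 2 * c * ((fA f j (x j) - fA f k (x k)) * (fA f j (x j) - fA f k (x k)) *
       (fp f j (x j) - fp f k (x k))) ≠ 0 :=
        mul_ne_zero (mul_ne_zero two_ne_zero h.hc) (mul_ne_zero (mul_ne_zero hA1 hA1) hp1)
      apply hne
      linear_combination -h3
  have e2 : ∀ x ∈ U, ∑ l, f l (x l) = 0 →
      2 * c * (fp f i (x i) - fp f m (x m))
       - fr f i (x i) * fp f m (x m) + fp f i (x i) * fr f m (x m) = 0 := by
    intro x hx hM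
    have h1 := h.eq1_im hx hM
    rw [e1 x hx hM, mul_zero] at h1
    exact (mul_eq_zero.1 h1.symm).resolve_left (sub_ne_zero.2 (hA x hx hM))
  intro x hx hM
  have key : ∀ α β, α ≠ β → fu f α (x α) ≠ 0 → fu f β (x β) ≠ 0 →
      (2 * fp f m (x m) * ep α β m * fr f i (x i) + fA f m (x m) * (fs f i (x i) * ep α β i)
        - (2 * fp f i (x i) * ep α β i * fr f m (x m) + fA f i (x i) * (fs f m (x m) * ep α β m)) = 0)
      ∧ (2 * c * (fr f i (x i) * ep α β i - fr f m (x m) * ep α β m)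
       - (fs f i (x i) * ep α β i * fp f m (x m) + fr f i (x i) * (fr f m (x m) * ep α β m))
       + (fr f i (x i) * ep α β i * fr f m (x m) + fp f i (x i) * (fs f m (x m) * ep α β m)) = 0) := by
    intro α β hab ha hb
    obtain ⟨γ, g0, gU, gA, gp, gr, gS⟩ := jets h.hf h.hU hx hM α β hab ha hb
    have gri := gr i (h.hui x hx)
    have grm := gr m (h.hum x hx)
    constructor
    · have hd := ((gA m).mul gri).sub ((gA i).mul grm)
      have := zero_deriv hd (by filter_upwards [gU] with t ht using e1 _ ht.1 ht.2)
      simpa only [g0] using this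
    · have hd := ((((gp i).sub (gp m)).const_mul (2 * c)).sub (gri.mul (gp m))).add ((gp i).mul grm)
      have := zero_deriv hd (by filter_upwards [gU] with t ht using e2 _ ht.1 ht.2)
      simpa only [g0] using this
  obtain ⟨a1, a2⟩ := key i j h.hij (h.hui x hx) (h.huj x hx)
  obtain ⟨b1, b2⟩ := key m j h.hjm.symm (h.hum x hx) (h.huj x hx)
  simp only [ep, h.hij, h.him, h.him.symm, h.hjm.symm, if_true, if_false] at a1 a2 b1 b2
  have c1 := e1 x hx hM
  have c2 := e2 x hx hM
  have hAi := Apos (h.hui x hx)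
  have hAm := Apos (h.hum x hx)
  have hne := sub_ne_zero.2 (hA' x hx hM)
  have hc := h.hc
  generalize fA f i (x i) = Ai at *
  generalize fA f m (x m) = Am at *
  generalize fp f i (x i) = pi at *
  generalize fp f m (x m) = pm at *
  generalize fr f i (x i) = ri at *
  generalize fr f m (x m) = rm at *
  generalize fs f i (x i) = si at *
  generalize fs f m (x m) = sm at *
  obtain ⟨κ, rfl⟩ : ∃ κ, ri = κ * Ai := ⟨ri / Ai, by field_simp⟩
  have hrm : rm = κ * Am := by
    apply mul_left_cancel₀ hAi.ne'
    linear_combination -c1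
  subst hrm
  have hsi : si = 2 * pi * κ := by
    apply mul_left_cancel₀ hAm.ne'
    linear_combination a1
  have hsm : sm = 2 * pm * κ := by
    apply mul_left_cancel₀ hAi.ne'
    linear_combination -b1
  subst hsi hsm
  have hk : 2 * c * κ * (Ai - Am) = 0 := by linear_combination a2 + b2
  have hκ : κ = 0 := by
    rcases mul_eq_zero.1 hk with h' | h'
    · exact (mul_eq_zero.1 h').resolve_left (mul_ne_zero two_ne_zero hc)
    · exact absurd h' hne
  subst hκ
  have : 2 * c * (pi - pm) = 0 := by linear_combination c2
  exact sub_eq_zero.1 ((mul_eq_zero.1 this).resolve_left (mul_ne_zero two_ne_zero hc))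

lemma exists_A_jk (h : Ctx f c i j k m U) {x} (hx : x ∈ U) (hM : ∑ l, f l (x l) = 0) :
    ∃ y ∈ U, ∑ l, f l (y l) = 0 ∧ fA f j (y j) ≠ fA f k (y k) := by
  by_contra! hcon
  have e : ∀ y ∈ U, ∑ l, f l (y l) = 0 → fA f j (y j) - fA f k (y k) = 0 :=
    fun y h1 h2 => sub_eq_zero.2 (hcon y h1 h2)
  have hj : fp f j (x j) = 0 := by
    obtain ⟨γ, g0, gU, gA, gp, gr, gS⟩ := jets h.hf h.hU hx hM j m h.hjm (h.huj x hx) (h.hum x hx)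
    have := zero_deriv ((gA j).sub (gA k)) (by filter_upwards [gU] with t ht using e _ ht.1 ht.2)
    simpa [ep, h.hjk.symm, h.hkm] using this
  have hk : fp f k (x k) = 0 := by
    obtain ⟨γ, g0, gU, gA, gp, gr, gS⟩ := jets h.hf h.hU hx hM k m h.hkm (h.huk x hx) (h.hum x hx)
    have := zero_deriv ((gA j).sub (gA k)) (by filter_upwards [gU] with t ht using e _ ht.1 ht.2)
    simpa [ep, h.hjk, h.hjm] using this
  have := h.he x hx hM j k h.hjk h.hjm h.hkm
  rw [hj, hk] at this
  exact h.rhs_ne hx j k (by rw [← this]; ring)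

lemma exists_A_im (h : Ctx f c i j k m U) {x} (hx : x ∈ U) (hM : ∑ l, f l (x l) = 0) :
    ∃ y ∈ U, ∑ l, f l (y l) = 0 ∧ fA f i (y i) ≠ fA f m (y m) := by
  by_contra! hcon
  have e : ∀ y ∈ U, ∑ l, f l (y l) = 0 → fA f i (y i) - fA f m (y m) = 0 :=
    fun y h1 h2 => sub_eq_zero.2 (hcon y h1 h2)
  have hj : fp f i (x i) = 0 := by
    obtain ⟨γ, g0, gU, gA, gp, gr, gS⟩ := jets h.hf h.hU hx hM i j h.hij (h.hui x hx) (h.huj x hx)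
    have := zero_deriv ((gA i).sub (gA m)) (by filter_upwards [gU] with t ht using e _ ht.1 ht.2)
    simpa [ep, h.him.symm, h.hjm.symm] using this
  have hk : fp f m (x m) = 0 := by
    obtain ⟨γ, g0, gU, gA, gp, gr, gS⟩ :=
      jets h.hf h.hU hx hM m j h.hjm.symm (h.hum x hx) (h.huj x hx)
    have := zero_deriv ((gA i).sub (gA m)) (by filter_upwards [gU] with t ht using e _ ht.1 ht.2)
    simpa [ep, h.him, h.hij] using this
  have := h.he x hx hM i j h.hij h.him h.hjm
  rw [hj, hk] at this
  exact h.rhs_ne hx i j (by rw [← this]; ring)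

lemma contA (hf : ∀ k, ContDiff ℝ (⊤ : ℕ∞) (f k)) (l : Fin n) :
    Continuous (fun x : Fin n → ℝ => fA f l (x l)) :=
  (((fu_cd hf l).continuous.comp (continuous_apply l)).pow 2)

lemma contp (hf : ∀ k, ContDiff ℝ (⊤ : ℕ∞) (f k)) (l : Fin n) :
    Continuous (fun x : Fin n → ℝ => fp f l (x l)) :=
  ((fp_cd hf l).continuous.comp (continuous_apply l))

/-- one shrinking step: all `A` conditions for `i | j k` plus the dichotomy for `p j`, `p k`. -/
lemma shrink (h : Ctx f c i j k m U) (hne : ∃ x ∈ U, ∑ l, f l (x l) = 0) :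
    ∃ V ⊆ U, IsOpen V ∧ (∃ x ∈ V, ∑ l, f l (x l) = 0) ∧
      (∀ x ∈ V, fA f j (x j) ≠ fA f k (x k)) ∧
      (((∀ x ∈ V, ∑ l, f l (x l) = 0 → fp f j (x j) = fp f k (x k))) ∨
      ((∀ x ∈ V, fp f j (x j) ≠ fp f k (x k)) ∧
        ∀ x ∈ V, ∑ l, f l (x l) = 0 → fp f i (x i) = fp f m (x m))) := by
  obtain ⟨x, hx, hM⟩ := hne
  obtain ⟨x1, hx1, hM1, hA1⟩ := h.exists_A_jk hx hM
  have o1 : IsOpen (U ∩ {x | fA f j (x j) ≠ fA f k (x k)}) :=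
    h.hU.inter (isOpen_ne_fun (contA h.hf j) (contA h.hf k))
  set U1 := U ∩ {x | fA f j (x j) ≠ fA f k (x k)} with hU1
  have h1 : Ctx f c i j k m U1 := h.mono o1 Set.inter_subset_left
  have hx1' : x1 ∈ U1 := ⟨hx1, hA1⟩
  obtain ⟨x2, hx2, hM2, hA2⟩ := h1.exists_A_im hx1' hM1
  have o2 : IsOpen (U1 ∩ {x | fA f i (x i) ≠ fA f m (x m)}) :=
    o1.inter (isOpen_ne_fun (contA h.hf i) (contA h.hf m))
  set U2 := U1 ∩ {x | fA f i (x i) ≠ fA f m (x m)} with hU2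
  have h2 : Ctx f c i j k m U2 := h1.mono o2 Set.inter_subset_left
  have hx2' : x2 ∈ U2 := ⟨hx2, hA2⟩
  by_cases hcase : ∀ x ∈ U2, ∑ l, f l (x l) = 0 → fp f j (x j) = fp f k (x k)
  · exact ⟨U2, fun y hy => hy.1.1, o2, ⟨x2, hx2', hM2⟩, fun y hy => hy.1.2, Or.inl hcase⟩
  · push Not at hcase
    obtain ⟨x3, hx3, hM3, hp3⟩ := hcase
    have o3 : IsOpen (U2 ∩ {x | fp f j (x j) ≠ fp f k (x k)}) :=
      o2.inter (isOpen_ne_fun (contp h.hf j) (contp h.hf k))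
    set U3 := U2 ∩ {x | fp f j (x j) ≠ fp f k (x k)} with hU3
    have h3 : Ctx f c i j k m U3 := h2.mono o3 Set.inter_subset_left
    refine ⟨U3, fun y hy => hy.1.1.1, o3, ⟨x3, ⟨hx3, hp3⟩, hM3⟩, fun y hy => hy.1.1.2,
      Or.inr ⟨fun y hy => hy.2, ?_⟩⟩
    exact h3.main_alt (fun y hy _ => hy.1.1.2) (fun y hy _ => hy.1.2) (fun y hy _ => hy.2)

/-- pointwise: two of the `p`s agree with `p m` implies the third does. -/
lemma two (h : Ctx f c i j k m U) {x} (hx : x ∈ U) (hM : ∑ l, f l (x l) = 0)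
    (hi : fp f i (x i) = fp f m (x m)) (hj : fp f j (x j) = fp f m (x m)) :
    fp f k (x k) = fp f m (x m) := by
  have h1 := h.he x hx hM i j h.hij h.him h.hjm
  have hr := h.rhs_ne hx i j
  have h2 := h.eq1 hx hM
  have hAi := Apos (h.hui x hx)
  have hAj := Apos (h.huj x hx)
  have hAm := Apos (h.hum x hx)
  rw [hi, hj] at h1 h2
  have hp : fp f m (x m) ≠ 0 := by
    intro h0; rw [h0] at h1; apply hr; rw [← h1]; ring
  have hS : c * (∑ l, fA f l (x l)) = fp f m (x m) * fp f m (x m) := by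
    have : fA f i (x i) + fA f j (x j) + fA f m (x m) ≠ 0 := by positivity
    apply mul_right_cancel₀ this
    linear_combination -h1
  rw [hS] at h2
  have h3 : (fp f m (x m) - fp f k (x k)) * (fp f m (x m) * (fA f i (x i) + fA f m (x m))) = 0 := by
    linear_combination h2
  have : fp f m (x m) * (fA f i (x i) + fA f m (x m)) ≠ 0 := mul_ne_zero hp (by positivity)
  exact (sub_eq_zero.1 ((mul_eq_zero.1 h3).resolve_right this)).symm

lemma three (h : Ctx f c i j k m U) {x} (hx : x ∈ U) (hM : ∑ l, f l (x l) = 0)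
    (hA : fA f j (x j) ≠ fA f k (x k))
    (hij : fp f i (x i) = fp f j (x j)) (hjk : fp f j (x j) = fp f k (x k)) :
    fp f i (x i) = fp f m (x m) := by
  have h1 := h.he x hx hM i j h.hij h.him h.hjm
  have hr := h.rhs_ne hx i j
  have h2 := h.eq1 hx hM
  have hAm := Apos (h.hum x hx)
  rw [← hjk, sub_self, zero_mul, zero_sub, neg_eq_zero] at h2
  have h3 := (mul_eq_zero.1 h2).resolve_left (sub_ne_zero.2 hA)
  rw [← hij] at h1
  have hp : fp f i (x i) ≠ 0 := by
    intro h0; rw [h0] at h1; apply hr; rw [← h1]; ring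
  have h4 : fA f m (x m) * fp f i (x i) * (fp f i (x i) - fp f m (x m)) = 0 := by
    linear_combination h1 + (fA f i (x i) + fA f j (x j) + fA f m (x m)) * h3
  exact sub_eq_zero.1 ((mul_eq_zero.1 h4).resolve_left (mul_ne_zero hAm.ne' hp))

lemma good (h : Ctx f c i j k m U) (hne : ∃ x ∈ U, ∑ l, f l (x l) = 0) :
    ∃ x ∈ U, ∑ l, f l (x l) = 0 ∧ deriv (fp f i) (x i) = 0 ∧ deriv (fp f m) (x m) = 0 ∧
      fp f i (x i) = fp f m (x m) ∧ c * (∑ l, fA f l (x l)) = (fp f m (x m)) ^ 2 := by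
  obtain ⟨V1, s1, o1, n1, A1, d1⟩ := h.shrink hne
  have h1 := h.mono o1 s1
  obtain ⟨V2, s2, o2, n2, A2, d2⟩ := h1.rot.shrink n1
  have h2 := h1.mono o2 s2
  obtain ⟨V3, s3, o3, n3, A3, d3⟩ := h2.rot.rot.shrink n2
  have h3 := h2.mono o3 s3
  have all : ∀ x ∈ V3, ∑ l, f l (x l) = 0 → fp f i (x i) = fp f m (x m) ∧
      fp f j (x j) = fp f m (x m) := by
    intro x hx hM
    have e1 : fp f j (x j) = fp f k (x k) ∨
        fp f j (x j) ≠ fp f k (x k) ∧ fp f i (x i) = fp f m (x m) :=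
      d1.imp (fun d => d x (s2 (s3 hx)) hM) (fun d => ⟨d.1 x (s2 (s3 hx)), d.2 x (s2 (s3 hx)) hM⟩)
    have e2 : fp f k (x k) = fp f i (x i) ∨
        fp f k (x k) ≠ fp f i (x i) ∧ fp f j (x j) = fp f m (x m) :=
      d2.imp (fun d => d x (s3 hx) hM) (fun d => ⟨d.1 x (s3 hx), d.2 x (s3 hx) hM⟩)
    have e3 : fp f i (x i) = fp f j (x j) ∨
        fp f i (x i) ≠ fp f j (x j) ∧ fp f k (x k) = fp f m (x m) :=
      d3.imp (fun d => d x hx hM) (fun d => ⟨d.1 x hx, d.2 x hx hM⟩)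
    have t1 := h3.two hx hM
    have t2 := h3.rot.two hx hM
    have t3 := h3.rot.rot.two hx hM
    have t4 := h3.three hx hM (A1 x (s2 (s3 hx)))
    grind
  obtain ⟨x, hx, hM⟩ := n3
  obtain ⟨pi, pj⟩ := all x hx hM
  refine ⟨x, s1 (s2 (s3 hx)), hM, ?_, ?_, pi, ?_⟩
  · obtain ⟨γ, g0, gU, gA, gp, gr, gS⟩ :=
      jets h.hf o3 hx hM i j h.hij (h3.hui x hx) (h3.huj x hx)
    have := zero_deriv ((gp i).sub (gp m))
      (by filter_upwards [gU] with t ht using sub_eq_zero.2 (all _ ht.1 ht.2).1)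
    simpa [ep, h.him.symm, h.hjm.symm, fr, h3.hui x hx] using this
  · obtain ⟨γ, g0, gU, gA, gp, gr, gS⟩ :=
      jets h.hf o3 hx hM m j h.hjm.symm (h3.hum x hx) (h3.huj x hx)
    have := zero_deriv ((gp i).sub (gp m))
      (by filter_upwards [gU] with t ht using sub_eq_zero.2 (all _ ht.1 ht.2).1)
    simpa [ep, h.him, h.hij, fr, h3.hum x hx] using this
  · have e := h3.he x hx hM i j h.hij h.him h.hjm
    rw [pi, pj] at e
    have hAi := Apos (h3.hui x hx)
    have hAj := Apos (h3.huj x hx)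
    have hAm := Apos (h3.hum x hx)
    have : fA f i (x i) + fA f j (x j) + fA f m (x m) ≠ 0 := by positivity
    apply mul_right_cancel₀ this
    linear_combination -e

end Ctx

/-- hypotheses without nondegeneracy of `i,j,k` -/
structure Pre {n : ℕ} (f : Fin n → ℝ → ℝ) (c : ℝ) (m : Fin n)
    (U : Set (Fin n → ℝ)) : Prop where
  hf : ∀ k, ContDiff ℝ (⊤ : ℕ∞) (f k)
  hc : c ≠ 0
  hU : IsOpen U
  hum : ∀ x ∈ U, fu f m (x m) ≠ 0
  he : ∀ x ∈ U, ∑ l, f l (x l) = 0 → ∀ α β : Fin n, α ≠ β → α ≠ m → β ≠ m →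
    fA f α (x α) * fp f β (x β) * fp f m (x m) + fA f β (x β) * fp f α (x α) * fp f m (x m) +
      fA f m (x m) * fp f α (x α) * fp f β (x β) =
      c * (∑ l, fA f l (x l)) * (fA f α (x α) + fA f β (x β) + fA f m (x m))

namespace Pre
variable {n : ℕ} {f : Fin n → ℝ → ℝ} {c : ℝ} {m : Fin n} {U : Set (Fin n → ℝ)}

lemma mono (h : Pre f c m U) {V : Set (Fin n → ℝ)} (hV : IsOpen V) (hVU : V ⊆ U) :
    Pre f c m V :=
  { h with
    hU := hV
    hum := fun x hx => h.hum x (hVU hx)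
    he := fun x hx => h.he x (hVU hx) }

lemma exists_nz (h : Pre f c m U) {i j : Fin n} (hij : i ≠ j) (him : i ≠ m) (hjm : j ≠ m)
    (hne : ∃ x ∈ U, ∑ l, f l (x l) = 0) :
    ∃ V ⊆ U, IsOpen V ∧ (∃ x ∈ V, ∑ l, f l (x l) = 0) ∧ ∀ x ∈ V, fu f i (x i) ≠ 0 := by
  obtain ⟨x, hx, hM⟩ := hne
  suffices hs : ∃ y ∈ U, ∑ l, f l (y l) = 0 ∧ fu f i (y i) ≠ 0 by
    obtain ⟨y, hy, hyM, hyu⟩ := hs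
    refine ⟨U ∩ {x | fu f i (x i) ≠ 0}, Set.inter_subset_left, ?_, ⟨y, ⟨hy, hyu⟩, hyM⟩,
      fun z hz => hz.2⟩
    exact h.hU.inter
      (isOpen_ne_fun ((fu_cd h.hf i).continuous.comp (continuous_apply i)) continuous_const)
  by_cases hu : fu f i (x i) = 0
  swap
  · exact ⟨x, hx, hM, hu⟩
  have hp : fp f i (x i) ≠ 0 := by
    intro hp
    have e := h.he x hx hM i j hij him hjm
    have hm := Ctx.Apos (h.hum x hx)
    have h0 : ∀ l, 0 ≤ fA f l (x l) := fun l => sq_nonneg _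
    have h1 : fA f m (x m) ≤ ∑ l, fA f l (x l) :=
      Finset.single_le_sum (f := fun l => fA f l (x l)) (fun l _ => h0 l) (Finset.mem_univ m)
    have h2 := h0 i
    have h3 := h0 j
    have hA : fA f i (x i) = 0 := by simp [fA, hu]
    have : c * (∑ l, fA f l (x l)) * (fA f i (x i) + fA f j (x j) + fA f m (x m)) ≠ 0 := by
      refine mul_ne_zero (mul_ne_zero h.hc ?_) ?_ <;> linarith
    apply this
    rw [← e, hA, hp]; ring
  obtain ⟨γ, h0, h1, h2, h3, h4⟩ := curve h.hf x i m him (h.hum x hx) 1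
  have hd : HasDerivAt (fu f i) (fp f i (x i)) (x i) :=
    (cd_diff (fu_cd h.hf i) (x i)).hasDerivAt
  have hev : ∀ᶠ s in 𝓝[≠] (x i), fu f i s ≠ 0 := hd.eventually_ne hp
  have hcont : ContinuousAt γ 0 := by
    refine continuousAt_pi.2 fun l => ?_
    by_cases hl : l = i
    · subst hl
      simp only [h1]
      fun_prop
    · by_cases hl2 : l = m
      · subst hl2; exact h3.continuousAt
      · simp only [h2 l hl hl2]; exact continuousAt_const
  have hUev : ∀ᶠ t in 𝓝 (0:ℝ), γ t ∈ U := hcont.eventually_mem (by rw [h0]; exact h.hU.mem_nhds hx)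
  have ht : Tendsto (fun t : ℝ => γ t i) (𝓝[≠] 0) (𝓝[≠] (x i)) := by
    apply tendsto_nhdsWithin_of_tendsto_nhds_of_eventually_within
    · have : Tendsto (fun t : ℝ => γ t i) (𝓝 0) (𝓝 (x i)) := by
        have := (continuousAt_pi.1 hcont i).tendsto
        rwa [h0] at this
      exact this.mono_left nhdsWithin_le_nhds
    · filter_upwards [self_mem_nhdsWithin] with t ht
      simpa [h1] using ht
  obtain ⟨t, t1, t2, t3⟩ := ((ht.eventually hev).and
    ((hUev.and h4).filter_mono nhdsWithin_le_nhds)).exists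
  exact ⟨γ t, t2, t3.trans hM, t1⟩

lemma good (h : Pre f c m U) {i j k : Fin n} (hij : i ≠ j) (hik : i ≠ k) (him : i ≠ m)
    (hjk : j ≠ k) (hjm : j ≠ m) (hkm : k ≠ m) (hne : ∃ x ∈ U, ∑ l, f l (x l) = 0) :
    ∃ x ∈ U, ∑ l, f l (x l) = 0 ∧ deriv (fp f i) (x i) = 0 ∧ deriv (fp f m) (x m) = 0 ∧
      fp f i (x i) = fp f m (x m) ∧ c * (∑ l, fA f l (x l)) = (fp f m (x m)) ^ 2 := by
  obtain ⟨V1, s1, o1, n1, u1⟩ := h.exists_nz hij him hjm hne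
  have h1 := h.mono o1 s1
  obtain ⟨V2, s2, o2, n2, u2⟩ := h1.exists_nz hij.symm hjm him n1
  have h2 := h1.mono o2 s2
  obtain ⟨V3, s3, o3, n3, u3⟩ := h2.exists_nz hik.symm hkm him n2
  have h3 := h2.mono o3 s3
  have hC : Ctx f c i j k m V3 :=
    { h3 with
      hij := hij, hik := hik, him := him, hjk := hjk, hjm := hjm, hkm := hkm
      hui := fun x hx => u1 x (s2 (s3 hx))
      huj := fun x hx => u2 x (s3 hx)
      huk := u3 }
  obtain ⟨x, hx, hr⟩ := hC.good n3
  exact ⟨x, s1 (s2 (s3 hx)), hr⟩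

/-- the conclusion holds at every point of the surface, by density. -/
lemma all (h : Pre f c m U) {i j k : Fin n} (hij : i ≠ j) (hik : i ≠ k) (him : i ≠ m)
    (hjk : j ≠ k) (hjm : j ≠ m) (hkm : k ≠ m) {x} (hx : x ∈ U) (hM : ∑ l, f l (x l) = 0) :
    deriv (fp f i) (x i) = 0 ∧ deriv (fp f m) (x m) = 0 ∧
      fp f i (x i) = fp f m (x m) ∧ c * (∑ l, fA f l (x l)) = (fp f m (x m)) ^ 2 := by
  have key : ∀ φ ψ : (Fin n → ℝ) → ℝ, Continuous φ → Continuous ψ →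
      (∀ y, (deriv (fp f i) (y i) = 0 ∧ deriv (fp f m) (y m) = 0 ∧
      fp f i (y i) = fp f m (y m) ∧ c * (∑ l, fA f l (y l)) = (fp f m (y m)) ^ 2) → φ y = ψ y) →
      φ x = ψ x := by
    intro φ ψ hφ hψ himp
    by_contra hne
    have o : IsOpen (U ∩ {y | φ y ≠ ψ y}) := h.hU.inter (isOpen_ne_fun hφ hψ)
    obtain ⟨y, hy, -, hg⟩ := (h.mono o Set.inter_subset_left).good hij hik him hjk hjm hkm
      ⟨x, ⟨hx, hne⟩, hM⟩
    exact hy.2 (himp y hg)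
  have cd : ∀ l, Continuous (fun y : Fin n → ℝ => deriv (fp f l) (y l)) := fun l =>
    (cd_deriv (fp_cd h.hf l)).continuous.comp (continuous_apply l)
  refine ⟨key _ _ (cd i) continuous_const fun y hy => hy.1,
    key _ _ (cd m) continuous_const fun y hy => hy.2.1,
    key _ _ (Ctx.contp h.hf i) (Ctx.contp h.hf m) fun y hy => hy.2.2.1,
    key _ _ (continuous_const.mul (continuous_finsetSum _ fun l _ => Ctx.contA h.hf l))
      ((Ctx.contp h.hf m).pow 2) fun y hy => hy.2.2.2⟩

end Pre

/-- zero derivative on an open interval. -/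
lemma const_of_deriv {g : ℝ → ℝ} {a b : ℝ} (hg : Differentiable ℝ g)
    (h0 : ∀ t ∈ Set.Ioo a b, deriv g t = 0) {s t : ℝ} (hs : s ∈ Set.Ioo a b)
    (ht : t ∈ Set.Ioo a b) : g s = g t :=
  isOpen_Ioo.is_const_of_deriv_eq_zero isPreconnected_Ioo hg.differentiableOn h0 hs ht

end SepHyp


/-- Theorem 4 (th-2): a separable hypersurface `f₁(x₁) + ⋯ + fₙ(xₙ) = 0` in ℝⁿ
(n > 3), with nonvanishing gradient and `fₙ'` nowhere zero, all of whose sectional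
curvatures (given on basis planes by `K(Xᵢ,Xⱼ) = (fᵢ'²fⱼ''fₙ'' + fⱼ'²fᵢ''fₙ'' +
fₙ'²fᵢ''fⱼ'')/((∑ₖfₖ'²)(fᵢ'²+fⱼ'²+fₙ'²))`) equal a nonzero constant `K₀/4`, is an
open subset of a round hypersphere `∑ₖ(xₖ + μₖ)² = r²`. -/
theorem stmt_15 {n : ℕ} (hn : 3 < n) (K₀ : ℝ) (hK₀ : K₀ ≠ 0)
    (f : Fin n → ℝ → ℝ) (a b : Fin n → ℝ)
    (hab : ∀ k, a k < b k) (hf : ∀ k, ContDiff ℝ (⊤ : ℕ∞) (f k))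
    (hgrad : ∀ x : Fin n → ℝ, (∀ l, x l ∈ Set.Ioo (a l) (b l)) →
      ∃ k, deriv (f k) (x k) ≠ 0)
    (hfn : ∀ t ∈ Set.Ioo (a ⟨n - 1, by omega⟩) (b ⟨n - 1, by omega⟩),
      deriv (f ⟨n - 1, by omega⟩) t ≠ 0)
    (hsurf : ∀ k, ∀ t ∈ Set.Ioo (a k) (b k), ∃ x : Fin n → ℝ, x k = t ∧
      (∀ l, x l ∈ Set.Ioo (a l) (b l)) ∧ (∑ l, f l (x l)) = 0)
    (hK : ∀ x : Fin n → ℝ, (∀ l, x l ∈ Set.Ioo (a l) (b l)) → (∑ l, f l (x l)) = 0 →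
      ∀ i j : Fin n, (i : ℕ) < j → (j : ℕ) < n - 1 →
        K₀ / 4 =
          ((deriv (f i) (x i)) ^ 2 * deriv (deriv (f j)) (x j) *
              deriv (deriv (f ⟨n - 1, by omega⟩)) (x ⟨n - 1, by omega⟩) +
            (deriv (f j) (x j)) ^ 2 * deriv (deriv (f i)) (x i) *
              deriv (deriv (f ⟨n - 1, by omega⟩)) (x ⟨n - 1, by omega⟩) +
            (deriv (f ⟨n - 1, by omega⟩) (x ⟨n - 1, by omega⟩)) ^ 2 *
              deriv (deriv (f i)) (x i) * deriv (deriv (f j)) (x j)) /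
          ((∑ k, (deriv (f k) (x k)) ^ 2) *
            ((deriv (f i) (x i)) ^ 2 + (deriv (f j) (x j)) ^ 2 +
              (deriv (f ⟨n - 1, by omega⟩) (x ⟨n - 1, by omega⟩)) ^ 2))) :
    ∃ (μ : Fin n → ℝ) (r : ℝ), 0 < r ∧
      ∀ x : Fin n → ℝ, (∀ l, x l ∈ Set.Ioo (a l) (b l)) → (∑ l, f l (x l)) = 0 →
        (∑ k, (x k + μ k) ^ 2) = r ^ 2 := by
  classical
  set m : Fin n := ⟨n - 1, by omega⟩ with hm
  set U : Set (Fin n → ℝ) := Set.pi Set.univ (fun l => Set.Ioo (a l) (b l)) with hUdef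
  have memU : ∀ x, x ∈ U ↔ ∀ l, x l ∈ Set.Ioo (a l) (b l) := by
    intro x; simp [hUdef, Set.mem_pi]
  have hpre : SepHyp.Pre f (K₀ / 4) m U := by
    refine ⟨hf, by simpa using hK₀, isOpen_set_pi Set.finite_univ fun l _ => isOpen_Ioo, ?_, ?_⟩
    · intro x hx
      exact hfn _ ((memU x).1 hx m)
    · intro x hx hM
      have hum : deriv (f m) (x m) ≠ 0 := hfn _ ((memU x).1 hx m)
      have hsum : (∑ k, (deriv (f k) (x k)) ^ 2) ≠ 0 := by
        have h1 : (deriv (f m) (x m)) ^ 2 ≤ ∑ k, (deriv (f k) (x k)) ^ 2 :=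
          Finset.single_le_sum (f := fun k => (deriv (f k) (x k)) ^ 2)
            (fun k _ => sq_nonneg _) (Finset.mem_univ m)
        have : 0 < (deriv (f m) (x m)) ^ 2 := by positivity
        linarith
      have main : ∀ α β : Fin n, (α : ℕ) < β → (β : ℕ) < n - 1 →
          SepHyp.fA f α (x α) * SepHyp.fp f β (x β) * SepHyp.fp f m (x m) +
            SepHyp.fA f β (x β) * SepHyp.fp f α (x α) * SepHyp.fp f m (x m) +
            SepHyp.fA f m (x m) * SepHyp.fp f α (x α) * SepHyp.fp f β (x β) =
          K₀ / 4 * (∑ l, SepHyp.fA f l (x l)) *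
            (SepHyp.fA f α (x α) + SepHyp.fA f β (x β) + SepHyp.fA f m (x m)) := by
        intro α β h1 h2
        have e := hK x ((memU x).1 hx) hM α β h1 h2
        have hden : (deriv (f α) (x α)) ^ 2 + (deriv (f β) (x β)) ^ 2 +
            (deriv (f m) (x m)) ^ 2 ≠ 0 := by positivity
        rw [eq_div_iff (mul_ne_zero hsum hden)] at e
        simp only [SepHyp.fA, SepHyp.fp, SepHyp.fu]
        linear_combination -e
      intro α β hab ham hbm
      have ha : (α : ℕ) < n - 1 := by
        have := α.2
        have : (α : ℕ) ≠ n - 1 := fun h => ham (Fin.ext h)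
        omega
      have hb : (β : ℕ) < n - 1 := by
        have := β.2
        have : (β : ℕ) ≠ n - 1 := fun h => hbm (Fin.ext h)
        omega
      rcases lt_or_gt_of_ne (fun h => hab (Fin.ext h) : (α : ℕ) ≠ β) with h | h
      · exact main α β h hb
      · have := main β α h ha
        linear_combination this
  -- conclusions at all points of the surface
  have hall : ∀ i, i ≠ m → ∀ x ∈ U, ∑ l, f l (x l) = 0 →
      deriv (SepHyp.fp f i) (x i) = 0 ∧ deriv (SepHyp.fp f m) (x m) = 0 ∧
      SepHyp.fp f i (x i) = SepHyp.fp f m (x m) ∧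
      K₀ / 4 * (∑ l, SepHyp.fA f l (x l)) = (SepHyp.fp f m (x m)) ^ 2 := by
    intro i him x hx hM
    obtain ⟨j, hj⟩ : ∃ j, j ∉ ({i, m} : Finset (Fin n)) := by
      by_contra! hcon
      have h1 := Finset.card_le_card (fun l _ => hcon l : Finset.univ ⊆ ({i, m} : Finset (Fin n)))
      have h2 := Finset.card_le_two (a := i) (b := m)
      simp only [Finset.card_univ, Fintype.card_fin] at h1
      omega
    obtain ⟨k, hk⟩ : ∃ k, k ∉ ({i, j, m} : Finset (Fin n)) := by
      by_contra! hcon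
      have h1 := Finset.card_le_card
        (fun l _ => hcon l : Finset.univ ⊆ ({i, j, m} : Finset (Fin n)))
      have h2 := Finset.card_le_three (a := i) (b := j) (c := m)
      simp only [Finset.card_univ, Fintype.card_fin] at h1
      omega
    simp only [Finset.mem_insert, Finset.mem_singleton, not_or] at hj hk
    exact hpre.all (Ne.symm hj.1) (Ne.symm hk.1) him (Ne.symm hk.2.1) hj.2 hk.2.2 hx hM
  obtain ⟨i0, hi0⟩ : ∃ i0 : Fin n, i0 ≠ m :=
    ⟨⟨0, by omega⟩, by simp only [hm, ne_eq, Fin.mk.injEq]; omega⟩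
  have hthird : ∀ l, ∀ t ∈ Set.Ioo (a l) (b l), deriv (SepHyp.fp f l) t = 0 := by
    intro l t ht
    obtain ⟨x, hxt, hxU, hM⟩ := hsurf l t ht
    rw [← hxt]
    by_cases hl : l = m
    · subst hl
      exact (hall i0 hi0 x ((memU x).2 hxU) hM).2.1
    · exact (hall l hl x ((memU x).2 hxU) hM).1
  have hmid : ∀ l, (a l + b l) / 2 ∈ Set.Ioo (a l) (b l) := fun l =>
    ⟨by linarith [hab l], by linarith [hab l]⟩
  obtain ⟨z, -, hzU, hzM⟩ := hsurf m _ (hmid m)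
  set P := SepHyp.fp f m (z m) with hP
  have hconst : ∀ l, ∀ t ∈ Set.Ioo (a l) (b l), SepHyp.fp f l t = P := by
    intro l t ht
    have h1 := SepHyp.const_of_deriv (SepHyp.cd_diff (SepHyp.fp_cd hf l)) (hthird l) ht (hzU l)
    rw [h1]
    by_cases hl : l = m
    · subst hl; rfl
    · exact (hall l hl z ((memU z).2 hzU) hzM).2.2.1
  have hS : ∀ x ∈ U, ∑ l, f l (x l) = 0 → K₀ / 4 * (∑ l, SepHyp.fA f l (x l)) = P ^ 2 := by
    intro x hx hM
    rw [(hall i0 hi0 x hx hM).2.2.2, hconst m _ ((memU x).1 hx m)]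
  have hSpos : 0 < ∑ l, SepHyp.fA f l (z l) := by
    have h1 : SepHyp.fA f m (z m) ≤ ∑ l, SepHyp.fA f l (z l) :=
      Finset.single_le_sum (f := fun l => SepHyp.fA f l (z l))
        (fun l _ => sq_nonneg _) (Finset.mem_univ m)
    have := SepHyp.Ctx.Apos (hpre.hum z ((memU z).2 hzU))
    linarith
  have hz := hS z ((memU z).2 hzU) hzM
  have hc0 : K₀ / 4 ≠ 0 := by simpa using hK₀
  have hPsq : P ^ 2 ≠ 0 := by rw [← hz]; exact mul_ne_zero hc0 hSpos.ne'
  have hP0 : P ≠ 0 := fun h => hPsq (by rw [h]; ring)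
  have hcpos : 0 < K₀ / 4 := by
    have : 0 < K₀ / 4 * (∑ l, SepHyp.fA f l (z l)) := by rw [hz]; positivity
    exact pos_of_mul_pos_left this hSpos.le
  have hlin : ∀ l, ∀ t ∈ Set.Ioo (a l) (b l),
      SepHyp.fu f l t = P * (t + (SepHyp.fu f l (z l) / P - z l)) := by
    intro l t ht
    have hd : ∀ s, HasDerivAt (fun s => SepHyp.fu f l s - P * s) (SepHyp.fp f l s - P) s := by
      intro s
      have h1 : HasDerivAt (SepHyp.fu f l) (SepHyp.fp f l s) s :=
        (SepHyp.cd_diff (SepHyp.fu_cd hf l) s).hasDerivAt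
      have h2 := h1.sub ((hasDerivAt_id s).const_mul P)
      rw [mul_one] at h2
      exact h2
    have h1 := SepHyp.const_of_deriv (fun s => (hd s).differentiableAt)
      (fun s hs => by rw [(hd s).deriv, hconst l s hs, sub_self]) ht (hzU l)
    field_simp
    linear_combination h1
  refine ⟨fun l => SepHyp.fu f l (z l) / P - z l, Real.sqrt (K₀ / 4)⁻¹,
    Real.sqrt_pos.2 (inv_pos.2 hcpos), ?_⟩
  intro x hxU hM
  rw [Real.sq_sqrt (inv_pos.2 hcpos).le]
  have h1 := hS x ((memU x).2 hxU) hM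
  have h2 : ∑ l, SepHyp.fA f l (x l) =
      P ^ 2 * ∑ l, (x l + (SepHyp.fu f l (z l) / P - z l)) ^ 2 := by
    rw [Finset.mul_sum]
    refine Finset.sum_congr rfl fun l _ => ?_
    rw [SepHyp.fA, hlin l _ (hxU l)]
    ring
  rw [h2] at h1
  apply eq_inv_of_mul_eq_one_right
  apply mul_left_cancel₀ hPsq
  linear_combination h1
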